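/- ℓ¹→ℓ^∞ decay estimate for the parabolic equation with kernel-bounded coefficients (Proposition 3.6): Let N∈ℕ, b>0, σ>0, and let B_{jk}(s)=B_{kj}(s)≥0 (j≠k, s∈[0,σ]) be measurable coefficients satisfying B_{jk}(s) ≥ b/(N(γ_j−γ_k)²) for all j≠k and 0≤s≤σ, where γ_k are the semicircle typical locations. Then there exists a universal constant C (independent of N, b, σ, B) such that: for every solution v:[0,σ]→ℝ^N of the system dv_i/ds = −Σ_{j≠i} B_{ij}(s)(v_i(s)−v_j(s)) whose initial datum satisfies Σ_{j=1}^N v_j(0)=0, one has max_i |v_i(s)| ≤ C (sb)^{−3} · (1/N) Σ_{j=1}^N |v_j(0)| for all 0≤s≤σ. -/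

import Mathlib

open MeasureTheory

/-- The semicircle density. -/
noncomputable def semicircle (x : ℝ) : ℝ := Real.sqrt (max (4 - x ^ 2) 0) / (2 * Real.pi)

/-- `γ : Fin N → ℝ` are the semicircle typical locations:
`∫_{-2}^{γ_k} ρ = (k + 1/2)/N` (with `k` running through `0,…,N-1`). -/
def IsTypicalLocation (N : ℕ) (γ : Fin N → ℝ) : Prop :=
  ∀ k : Fin N, γ k ∈ Set.Ioo (-2 : ℝ) 2 ∧
    (∫ x in Set.Ioo (-2 : ℝ) (γ k), semicircle x) = ((k : ℝ) + 1 / 2) / N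

lemma continuous_semicircle : Continuous semicircle := by
  unfold semicircle
  fun_prop

lemma semicircle_nonneg (x : ℝ) : 0 ≤ semicircle x := by
  unfold semicircle
  positivity

/-- The semicircle mass of an interval of length `d` is at least of order `d ^ (3 / 2)`. -/
lemma length_cube_le_semicircle_mass_sq {x y : ℝ} (hx : -2 ≤ x) (hxy : x ≤ y) (hy : y ≤ 2) :
    (y - x) ^ 3 ≤ 400 * (∫ t in x..y, semicircle t) ^ 2 := by
  set d := y - x with hd
  have hd0 : 0 ≤ d := by linarith
  have hsub : ∫ t in (x + d / 4)..(y - d / 4), semicircle t ≤ ∫ t in x..y, semicircle t :=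
    intervalIntegral.integral_mono_interval (by linarith) (by linarith) (by linarith)
      (Filter.Eventually.of_forall semicircle_nonneg)
      (continuous_semicircle.intervalIntegrable _ _)
  have hconst : ∫ _ in (x + d / 4)..(y - d / 4), √(d / 2) / (2 * Real.pi) ≤
      ∫ t in (x + d / 4)..(y - d / 4), semicircle t := by
    refine intervalIntegral.integral_mono_on (by linarith)
      (continuous_const.intervalIntegrable _ _) (continuous_semicircle.intervalIntegrable _ _) ?_
    intro t ⟨ht1, ht2⟩
    unfold semicircle
    gcongr
    refine le_max_of_le_left ?_
    rcases le_total t 0 with h | h <;> nlinarith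
  rw [intervalIntegral.integral_const, smul_eq_mul] at hconst
  have hlen : y - d / 4 - (x + d / 4) = d / 2 := by linarith
  rw [hlen] at hconst
  have hI : (d / 2 * (√(d / 2) / (2 * Real.pi))) ^ 2 ≤ (∫ t in x..y, semicircle t) ^ 2 := by
    gcongr
    exact hconst.trans hsub
  have hsq : (d / 2 * (√(d / 2) / (2 * Real.pi))) ^ 2 = d ^ 3 / (32 * Real.pi ^ 2) := by
    rw [mul_pow, div_pow √(d / 2), Real.sq_sqrt (by linarith : 0 ≤ d / 2)]
    field_simp
    ring
  have hpi : 32 * Real.pi ^ 2 ≤ 400 := by nlinarith [Real.pi_lt_d2, Real.pi_pos]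
  have hle : d ^ 3 / 400 ≤ d ^ 3 / (32 * Real.pi ^ 2) := by
    gcongr
  linarith

lemma IsTypicalLocation.integral_eq {N : ℕ} {γ : Fin N → ℝ} (hγ : IsTypicalLocation N γ)
    (i j : Fin N) : ∫ t in (γ i)..(γ j), semicircle t = ((j : ℝ) - i) / N := by
  have key : ∀ k, ∫ t in (-2 : ℝ)..(γ k), semicircle t = ((k : ℝ) + 1 / 2) / N := by
    intro k
    rw [intervalIntegral.integral_of_le (hγ k).1.1.le, integral_Ioc_eq_integral_Ioo, (hγ k).2]
  have h := intervalIntegral.integral_interval_sub_left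
    (continuous_semicircle.intervalIntegrable (-2) (γ j))
    (continuous_semicircle.intervalIntegrable (-2) (γ i)) (μ := volume)
  rw [← h, key, key]
  ring

lemma IsTypicalLocation.injective {N : ℕ} {γ : Fin N → ℝ} (hγ : IsTypicalLocation N γ) :
    Function.Injective γ := by
  intro i j hij
  have hN : (N : ℝ) ≠ 0 := by
    have := i.pos
    positivity
  have h := hγ.integral_eq i j
  rw [hij, intervalIntegral.integral_same, eq_comm, div_eq_zero_iff, or_iff_left hN] at h
  exact Fin.ext (by exact_mod_cast (sub_eq_zero.mp h).symm)

lemma IsTypicalLocation.abs_sub_cube_le {N : ℕ} {γ : Fin N → ℝ} (hγ : IsTypicalLocation N γ)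
    (i j : Fin N) : |γ i - γ j| ^ 3 ≤ 400 * (((i : ℝ) - j) / N) ^ 2 := by
  wlog h : γ i ≤ γ j generalizing i j
  · rw [abs_sub_comm, show ((i : ℝ) - j) / N = -(((j : ℝ) - i) / N) by ring, neg_sq]
    exact this j i (le_of_not_ge h)
  have h1 := length_cube_le_semicircle_mass_sq (hγ i).1.1.le h (hγ j).1.2.le
  rw [hγ.integral_eq] at h1
  rw [abs_sub_comm, abs_of_nonneg (by linarith),
    show ((i : ℝ) - j) / N = -(((j : ℝ) - i) / N) by ring, neg_sq]
  exact h1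

lemma le_card_filter_abs_sub_le {N : ℕ} (i : Fin N) {L : ℝ} (hL : 0 < L) (hLN : L ≤ N) :
    L ≤ ((Finset.univ.filter fun j : Fin N => |(i : ℝ) - j| ≤ L).card : ℝ) := by
  set n := ⌈L⌉₊
  have hn0 : 0 < n := Nat.ceil_pos.mpr hL
  have hnN : n ≤ N := Nat.ceil_le.mpr hLN
  have hnL : (n : ℝ) < L + 1 := Nat.ceil_lt_add_one hL.le
  have hi := i.isLt
  let f : Fin n → Fin N := fun x => ⟨min (i : ℕ) (N - n) + x, by omega⟩
  have hcard : (Finset.univ : Finset (Fin n)).card ≤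
      (Finset.univ.filter fun j : Fin N => |(i : ℝ) - j| ≤ L).card := by
    refine Finset.card_le_card_of_injOn f ?_ ?_
    · intro x _
      have hx := x.isLt
      have h1 : (i : ℕ) + 1 ≤ (f x : ℕ) + n := by simp only [f]; omega
      have h2 : (f x : ℕ) + 1 ≤ (i : ℕ) + n := by simp only [f]; omega
      have h1' : ((i : ℕ) : ℝ) + 1 ≤ ((f x : ℕ) : ℝ) + n := by exact_mod_cast h1
      have h2' : ((f x : ℕ) : ℝ) + 1 ≤ ((i : ℕ) : ℝ) + n := by exact_mod_cast h2
      simp only [Finset.coe_filter, Finset.mem_univ, true_and, Set.mem_ofPred_eq]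
      rw [abs_le]
      constructor <;> linarith
    · intro x _ y _ hxy
      have := congrArg Fin.val hxy
      simp only [f] at this
      exact Fin.ext (by omega)
  rw [Finset.card_univ, Fintype.card_fin] at hcard
  calc L ≤ n := Nat.le_ceil L
    _ ≤ _ := by exact_mod_cast hcard

/-- The number of typical locations within distance `q ^ 2` of a given one is at least of order
`N * q ^ 3`. -/
lemma IsTypicalLocation.le_card_near {N : ℕ} {γ : Fin N → ℝ} (hγ : IsTypicalLocation N γ)
    (i : Fin N) {q : ℝ} (hq : 0 < q) (hq20 : q ^ 3 ≤ 20) :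
    N * q ^ 3 / 20 ≤ ((Finset.univ.filter fun j : Fin N => |γ i - γ j| ≤ q ^ 2).card : ℝ) := by
  have hN : (0 : ℝ) < N := by exact_mod_cast i.pos
  refine (le_card_filter_abs_sub_le i (L := N * q ^ 3 / 20) (by positivity) ?_).trans ?_
  · rw [div_le_iff₀ (by norm_num)]
    gcongr
  · refine Nat.cast_le.mpr (Finset.card_le_card ?_)
    refine Finset.monotone_filter_right _ fun j _ hj => ?_
    have h1 := hγ.abs_sub_cube_le i j
    have h2 : (((i : ℝ) - j) / N) ^ 2 ≤ (q ^ 3 / 20) ^ 2 := by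
      rw [← sq_abs, abs_div, abs_of_pos hN]
      refine pow_le_pow_left₀ (by positivity) ?_ 2
      rw [div_le_iff₀ hN]
      linarith
    have h3 : |γ i - γ j| ^ 3 ≤ (q ^ 2) ^ 3 := by
      calc _ ≤ _ := h1
        _ ≤ 400 * (q ^ 3 / 20) ^ 2 := by gcongr
        _ = _ := by ring
    exact le_of_pow_le_pow_left₀ (by norm_num) (by positivity) h3

/-- At a maximum point, the kernel operator dominates a multiple of the maximum, up to an error
controlled by the `ℓ¹` norm. -/
lemma IsTypicalLocation.le_sum_at_max {N : ℕ} {γ : Fin N → ℝ} (hγ : IsTypicalLocation N γ)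
    {b q : ℝ} (hb : 0 < b) (hq : 0 < q) {i : Fin N} {β u : Fin N → ℝ}
    (hβ : ∀ j, i ≠ j → 0 ≤ β j ∧ b / (N * (γ i - γ j) ^ 2) ≤ β j)
    (hmax : ∀ j, u j ≤ u i) (hpos : 0 ≤ u i) (hsum : ∑ j, u j = 0) :
    b * (u i / (20 * q) - ((1 / N) * ∑ j, |u j|) / q ^ 4) ≤
      ∑ j ∈ Finset.univ.erase i, β j * (u i - u j) := by
  have hN : (0 : ℝ) < N := by exact_mod_cast i.pos
  have herase : ∀ (S : Finset (Fin N)) (r : ℝ), 0 < r → (∀ j ∈ S, |γ i - γ j| ≤ r) →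
      b / (N * r ^ 2) * ∑ j ∈ S, (u i - u j) ≤
        ∑ j ∈ Finset.univ.erase i, β j * (u i - u j) := by
    intro S r hr hS
    have h1 : ∑ j ∈ S.erase i, (u i - u j) = ∑ j ∈ S, (u i - u j) :=
      Finset.sum_erase _ (sub_self _)
    rw [← h1, Finset.mul_sum]
    calc _ ≤ ∑ j ∈ S.erase i, β j * (u i - u j) := by
          refine Finset.sum_le_sum fun j hj => ?_
          obtain ⟨hji, hjS⟩ := Finset.mem_erase.mp hj
          refine mul_le_mul_of_nonneg_right ?_ (sub_nonneg.mpr (hmax j))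
          refine le_trans ?_ (hβ j hji.symm).2
          have hne : γ i - γ j ≠ 0 := sub_ne_zero.mpr (hγ.injective.ne hji.symm)
          have hsq : (γ i - γ j) ^ 2 ≤ r ^ 2 := by
            rw [← sq_abs]
            gcongr
            exact hS j hjS
          gcongr
      _ ≤ _ := by
          refine Finset.sum_le_sum_of_subset_of_nonneg
            (Finset.erase_subset_erase _ (Finset.subset_univ _)) fun j hj _ => ?_
          exact mul_nonneg (hβ j (Finset.ne_of_mem_erase hj).symm).1 (sub_nonneg.mpr (hmax j))
  have hM : 0 ≤ ∑ j, |u j| := Finset.sum_nonneg fun _ _ => abs_nonneg _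
  rcases le_total (q ^ 3) 20 with hq20 | hq20
  · set S := Finset.univ.filter fun j : Fin N => |γ i - γ j| ≤ q ^ 2
    refine le_trans ?_ (herase S (q ^ 2) (by positivity)
      fun j hj => (Finset.mem_filter.mp hj).2)
    have hcard := hγ.le_card_near i hq hq20
    have hSsum : ∑ j ∈ S, u j ≤ ∑ j, |u j| :=
      (Finset.sum_le_sum fun j _ => le_abs_self (u j)).trans
        (Finset.sum_le_sum_of_subset_of_nonneg (Finset.subset_univ _)
          fun _ _ _ => abs_nonneg _)
    rw [Finset.sum_sub_distrib, Finset.sum_const, nsmul_eq_mul]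
    calc _ = b / (N * (q ^ 2) ^ 2) * (N * q ^ 3 / 20 * u i - ∑ j, |u j|) := by
          field_simp
      _ ≤ _ := by gcongr
  · refine le_trans ?_ (herase Finset.univ 4 (by norm_num) fun j _ => ?_)
    · rw [Finset.sum_sub_distrib, hsum, Finset.sum_const, nsmul_eq_mul, Finset.card_univ,
        Fintype.card_fin, sub_zero]
      have hq1 : 1 ≤ q := by
        by_contra! h
        have : q ^ 3 < 1 := pow_lt_one₀ hq.le h (by norm_num)
        linarith
      calc _ ≤ b * (u i / (20 * q) - 0) := by gcongr; positivity
        _ ≤ b * (u i / 16) := by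
          rw [sub_zero]
          gcongr
          linarith
        _ = _ := by field_simp; norm_num
    · obtain ⟨⟨h1, h2⟩, -⟩ := hγ i
      obtain ⟨⟨h3, h4⟩, -⟩ := hγ j
      rw [abs_le]
      constructor <;> linarith

lemma sum_mul_sum_erase_nonneg {ι : Type*} [Fintype ι] [DecidableEq ι] {β : ι → ι → ℝ}
    (hsymm : ∀ i j, β i j = β j i) (hnonneg : ∀ i j, i ≠ j → 0 ≤ β i j)
    {g : ℝ → ℝ} (hg : Monotone g) (u : ι → ℝ) :
    0 ≤ ∑ i, g (u i) * ∑ j ∈ Finset.univ.erase i, β i j * (u i - u j) := by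
  have h1 : ∀ i, ∑ j ∈ Finset.univ.erase i, β i j * (u i - u j) = ∑ j, β i j * (u i - u j) :=
    fun i => Finset.sum_erase _ (by simp)
  simp only [h1, Finset.mul_sum]
  have hswap : ∑ i, ∑ j, g (u i) * (β i j * (u i - u j)) =
      ∑ i, ∑ j, g (u j) * (β i j * (u j - u i)) := by
    rw [Finset.sum_comm]
    simp only [hsymm]
  have hadd : 0 ≤ ∑ i, ∑ j, g (u i) * (β i j * (u i - u j)) +
      ∑ i, ∑ j, g (u j) * (β i j * (u j - u i)) := by
    simp only [← Finset.sum_add_distrib]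
    refine Finset.sum_nonneg fun i _ => Finset.sum_nonneg fun j _ => ?_
    rcases eq_or_ne i j with rfl | hij
    · simp
    · have h := hnonneg i j hij
      have h2 : 0 ≤ (g (u i) - g (u j)) * (u i - u j) := by
        rcases le_total (u i) (u j) with h' | h'
        · exact mul_nonneg_of_nonpos_of_nonpos (sub_nonpos.mpr (hg h')) (sub_nonpos.mpr h')
        · exact mul_nonneg (sub_nonneg.mpr (hg h')) (sub_nonneg.mpr h')
      calc 0 ≤ β i j * ((g (u i) - g (u j)) * (u i - u j)) := mul_nonneg h h2
        _ = _ := by ring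
  linarith

/-- `v` solves the parabolic system with symmetric coefficients `B`, nonnegative off the
diagonal, on `[0, σ]`. -/
structure IsParabolicSolution {ι : Type*} [Fintype ι] [DecidableEq ι] (B : ℝ → ι → ι → ℝ)
    (σ : ℝ) (v : ℝ → ι → ℝ) : Prop where
  symm : ∀ s i j, B s i j = B s j i
  nonneg : ∀ s ∈ Set.Icc (0 : ℝ) σ, ∀ i j, i ≠ j → 0 ≤ B s i j
  hasDerivAt : ∀ i, ∀ s ∈ Set.Icc (0 : ℝ) σ, HasDerivAt (fun u => v u i)
    (-∑ j ∈ Finset.univ.erase i, B s i j * (v s i - v s j)) s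

namespace IsParabolicSolution

variable {ι : Type*} [Fintype ι] [DecidableEq ι] {B : ℝ → ι → ι → ℝ} {σ : ℝ} {v : ℝ → ι → ℝ}

lemma neg (h : IsParabolicSolution B σ v) : IsParabolicSolution B σ (fun s i => -v s i) where
  symm := h.symm
  nonneg := h.nonneg
  hasDerivAt i s hs := by
    refine (h.hasDerivAt i s hs).fun_neg.congr_deriv ?_
    rw [← Finset.sum_neg_distrib, ← Finset.sum_neg_distrib, ← Finset.sum_neg_distrib]
    exact Finset.sum_congr rfl fun j _ => by ring

/-- Sums of convex functions of the coordinates decrease along the flow. -/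
lemma sum_comp_le (h : IsParabolicSolution B σ v) {φ g : ℝ → ℝ}
    (hφ : ∀ x, HasDerivAt φ (g x) x) (hg : Monotone g) {s : ℝ} (hs : s ∈ Set.Icc 0 σ) :
    ∑ i, φ (v s i) ≤ ∑ i, φ (v 0 i) := by
  have hderiv : ∀ t ∈ Set.Icc (0 : ℝ) σ, HasDerivAt (fun t => ∑ i, φ (v t i))
      (∑ i, g (v t i) * -∑ j ∈ Finset.univ.erase i, B t i j * (v t i - v t j)) t :=
    fun t ht => HasDerivAt.fun_sum fun i _ => (hφ (v t i)).comp t (h.hasDerivAt i t ht)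
  have hanti : AntitoneOn (fun t => ∑ i, φ (v t i)) (Set.Icc 0 σ) := by
    refine antitoneOn_of_hasDerivWithinAt_nonpos (convex_Icc 0 σ)
      (fun t ht => (hderiv t ht).continuousAt.continuousWithinAt)
      (fun t ht => (hderiv t (interior_subset ht)).hasDerivWithinAt) fun t ht => ?_
    have := sum_mul_sum_erase_nonneg (h.symm t) (h.nonneg t (interior_subset ht)) hg (v t)
    simp only [mul_neg, Finset.sum_neg_distrib]
    linarith
  exact hanti ⟨le_rfl, hs.1.trans hs.2⟩ hs hs.1

lemma sum_eq (h : IsParabolicSolution B σ v) {s : ℝ} (hs : s ∈ Set.Icc 0 σ) :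
    ∑ i, v s i = ∑ i, v 0 i := by
  refine le_antisymm (h.sum_comp_le (fun x => hasDerivAt_id x) monotone_const hs) ?_
  have := h.sum_comp_le (fun x => (hasDerivAt_id x).fun_neg) monotone_const hs
  simpa using this

lemma sum_abs_le (h : IsParabolicSolution B σ v) {s : ℝ} (hs : s ∈ Set.Icc 0 σ) :
    ∑ i, |v s i| ≤ ∑ i, |v 0 i| := by
  have key : ∀ ε > (0 : ℝ), ∑ i, |v s i| ≤ ∑ i, |v 0 i| + Fintype.card ι * ε := by
    intro ε hε
    have hφ : ∀ x : ℝ, HasDerivAt (fun x => ε * √(1 + (x / ε) ^ 2))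
        (Real.sin (Real.arctan (x / ε))) x := by
      intro x
      have h1 : HasDerivAt (fun x : ℝ => 1 + (x / ε) ^ 2) (2 * (x / ε) * (1 / ε)) x := by
        simpa using (((hasDerivAt_id x).div_const ε).pow 2).const_add 1
      refine ((h1.sqrt (by positivity)).const_mul ε).congr_deriv ?_
      rw [Real.sin_arctan]
      have : √(1 + (x / ε) ^ 2) ≠ 0 := by positivity
      field_simp
    have hg : Monotone fun x : ℝ => Real.sin (Real.arctan (x / ε)) := by
      intro x y hxy
      refine Real.strictMonoOn_sin.monotoneOn
        ⟨(Real.neg_pi_div_two_lt_arctan _).le, (Real.arctan_lt_pi_div_two _).le⟩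
        ⟨(Real.neg_pi_div_two_lt_arctan _).le, (Real.arctan_lt_pi_div_two _).le⟩
        (Real.arctan_strictMono.monotone ?_)
      gcongr
    have hlow : ∀ x : ℝ, |x| ≤ ε * √(1 + (x / ε) ^ 2) := by
      intro x
      have : |x / ε| ≤ √(1 + (x / ε) ^ 2) := Real.abs_le_sqrt (by linarith)
      calc |x| = ε * |x / ε| := by rw [abs_div, abs_of_pos hε]; field_simp
        _ ≤ _ := by gcongr
    have hupp : ∀ x : ℝ, ε * √(1 + (x / ε) ^ 2) ≤ |x| + ε := by
      intro x
      have : √(1 + (x / ε) ^ 2) ≤ 1 + |x / ε| := by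
        refine Real.sqrt_le_iff.mpr ⟨by positivity, ?_⟩
        nlinarith [sq_abs (x / ε), abs_nonneg (x / ε)]
      calc _ ≤ ε * (1 + |x / ε|) := by gcongr
        _ = _ := by rw [abs_div, abs_of_pos hε]; field_simp; ring
    calc _ ≤ ∑ i, ε * √(1 + (v s i / ε) ^ 2) := Finset.sum_le_sum fun i _ => hlow _
      _ ≤ ∑ i, ε * √(1 + (v 0 i / ε) ^ 2) := h.sum_comp_le hφ hg hs
      _ ≤ ∑ i, (|v 0 i| + ε) := Finset.sum_le_sum fun i _ => hupp _
      _ = _ := by simp [Finset.sum_add_distrib]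
  refine le_of_forall_pos_le_add fun δ hδ => ?_
  have hc : (0 : ℝ) < Fintype.card ι + 1 := by positivity
  refine (key (δ / (Fintype.card ι + 1)) (by positivity)).trans ?_
  gcongr
  rw [mul_div_assoc', div_le_iff₀ hc]
  linarith

end IsParabolicSolution

/-- Maximum principle: a finite family of functions that starts nonpositive stays nonpositive,
provided that the derivative of a maximal member is negative whenever its value is positive. -/
lemma nonpos_of_deriv_neg_at_max {ι : Type*} [Finite ι] {σ : ℝ} {F F' : ι → ℝ → ℝ}
    (hF : ∀ i, ∀ s ∈ Set.Icc (0 : ℝ) σ, HasDerivAt (F i) (F' i s) s) (h0 : ∀ i, F i 0 ≤ 0)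
    (hneg : ∀ i, ∀ s ∈ Set.Icc (0 : ℝ) σ, 0 < s → 0 < F i s → (∀ j, F j s ≤ F i s) →
      F' i s < 0)
    {s : ℝ} (hs : s ∈ Set.Icc 0 σ) (i : ι) : F i s ≤ 0 := by
  by_contra! hpos
  have hmax : ∀ j, ∃ t ∈ Set.Icc 0 σ, ∀ u ∈ Set.Icc (0 : ℝ) σ, F j u ≤ F j t := fun j =>
    isCompact_Icc.exists_isMaxOn ⟨s, hs⟩
      fun t ht => (hF j t ht).continuousAt.continuousWithinAt
  choose t ht hle using hmax
  have : Nonempty ι := ⟨i⟩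
  obtain ⟨k, hk⟩ := Finite.exists_max fun j => F j (t j)
  have hkpos : 0 < F k (t k) := hpos.trans_le ((hle i s hs).trans (hk i))
  have htk : 0 < t k := by
    refine (ht k).1.lt_of_ne fun h => ?_
    rw [← h] at hkpos
    exact hkpos.not_ge (h0 k)
  have hlt := hneg k (t k) (ht k) htk hkpos fun j => (hle j _ (ht k)).trans (hk j)
  have hev := (hF k (t k) (ht k)).hasDerivWithinAt (s := Set.Iio (t k))
  have hslope := (hasDerivWithinAt_iff_tendsto_slope' Set.self_notMem_Iio).mp hev
  refine hlt.not_ge (ge_of_tendsto hslope ?_)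
  filter_upwards [Ioo_mem_nhdsLT htk] with u hu
  rw [slope_def_field]
  exact div_nonneg_of_nonpos
    (sub_nonpos.mpr (hle k u ⟨hu.1.le, hu.2.le.trans (ht k).2⟩)) (sub_nonpos.mpr hu.2.le)

lemma IsParabolicSolution.mul_cube_le {N : ℕ} {b σ : ℝ} (hb : 0 < b) {γ : Fin N → ℝ}
    (hγ : IsTypicalLocation N γ) {B : ℝ → Fin N → Fin N → ℝ} {v : ℝ → Fin N → ℝ}
    (h : IsParabolicSolution B σ v)
    (hB : ∀ s ∈ Set.Icc (0 : ℝ) σ, ∀ i j : Fin N, i ≠ j →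
      b / (N * (γ i - γ j) ^ 2) ≤ B s i j)
    (hsum : ∑ j, v 0 j = 0) {s : ℝ} (hs : s ∈ Set.Icc 0 σ) (i : Fin N) :
    v s i * (s * b) ^ 3 ≤ 80 ^ 4 * ((1 / N) * ∑ j, |v 0 j|) := by
  set M := (1 / (N : ℝ)) * ∑ j, |v 0 j|
  have hM0 : 0 ≤ M := by positivity
  rcases hs.1.eq_or_lt with rfl | hs0
  · simpa using hM0
  refine le_of_forall_pos_le_add fun ε hε => ?_
  set A := (80 ^ 4 * M + ε) / b ^ 3 with hA
  have hnonpos : s ^ 4 * v s i - A * s ≤ 0 := by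
    refine nonpos_of_deriv_neg_at_max (F := fun i t => t ^ 4 * v t i - A * t)
      (F' := fun i t => 4 * t ^ 3 * v t i +
        t ^ 4 * -(∑ j ∈ Finset.univ.erase i, B t i j * (v t i - v t j)) - A)
      (fun i t ht => ?_) (fun i => by simp) (fun i t ht ht0 hpos hmax => ?_) hs i
    · simpa using ((hasDerivAt_pow 4 t).fun_mul (h.hasDerivAt i t ht)).fun_sub
        ((hasDerivAt_id' t).const_mul A)
    · have hvpos : 0 ≤ v t i := by
        have hA0 : 0 ≤ A * t := by positivity
        have : 0 < t ^ 4 * v t i := by linarith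
        exact (pos_of_mul_pos_right this (by positivity)).le
      have hvmax : ∀ j, v t j ≤ v t i := fun j => by
        have := hmax j
        have h4 : t ^ 4 * v t j ≤ t ^ 4 * v t i := by linarith
        exact le_of_mul_le_mul_left h4 (by positivity)
      have hkey := hγ.le_sum_at_max hb (q := t * b / 80) (by positivity)
        (fun j hij => ⟨h.nonneg t ht i j hij, hB t ht i j hij⟩) hvmax hvpos
        ((h.sum_eq ht).trans hsum)
      have hMt : (1 / (N : ℝ)) * ∑ j, |v t j| ≤ M :=
        mul_le_mul_of_nonneg_left (h.sum_abs_le ht) (by positivity)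
      have hlow : b * (v t i / (20 * (t * b / 80)) - M / (t * b / 80) ^ 4) ≤
          ∑ j ∈ Finset.univ.erase i, B t i j * (v t i - v t j) :=
        le_trans (by gcongr) hkey
      have hmul := mul_le_mul_of_nonneg_left hlow (pow_nonneg ht0.le 4)
      have heq : t ^ 4 * (b * (v t i / (20 * (t * b / 80)) - M / (t * b / 80) ^ 4)) =
          4 * t ^ 3 * v t i - 80 ^ 4 * M / b ^ 3 := by
        field_simp
        ring
      have hAgt : 80 ^ 4 * M / b ^ 3 < A := by
        rw [hA]
        gcongr
        linarith
      rw [heq] at hmul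
      linarith
  have h3 : s ^ 3 * v s i ≤ A := by
    refine le_of_mul_le_mul_left (a := s) ?_ hs0
    linarith
  rw [hA, le_div_iff₀ (by positivity)] at h3
  linarith


/-- **ℓ¹ → ℓ^∞ decay estimate for the parabolic equation with kernel-bounded
coefficients** (Proposition 3.6).  There is a universal constant `C` such that for any
symmetric nonnegative measurable coefficients with `B_{jk}(s) ≥ b/(N(γ_j-γ_k)²)` on
`[0,σ]`, every solution `v` of `dv_i/ds = -Σ_{j≠i} B_{ij}(s)(v_i - v_j)` with
`Σ_j v_j(0) = 0` satisfies `max_i |v_i(s)| ≤ C (sb)^{-3} (1/N) Σ_j |v_j(0)|` for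
`0 ≤ s ≤ σ` (stated multiplicatively as `|v_i(s)| (sb)³ ≤ C ‖v(0)‖₁`). -/
theorem ell1_to_ellinfty_decay :
    ∃ C > (0 : ℝ), ∀ (N : ℕ) (b σ : ℝ), 0 < b → 0 < σ →
    ∀ γ : Fin N → ℝ, IsTypicalLocation N γ →
    ∀ B : ℝ → Fin N → Fin N → ℝ,
      (∀ i j, Measurable fun s => B s i j) →
      (∀ s, ∀ i j : Fin N, B s i j = B s j i) →
      (∀ s ∈ Set.Icc (0 : ℝ) σ, ∀ i j : Fin N, i ≠ j →
        0 ≤ B s i j ∧ b / (N * (γ i - γ j) ^ 2) ≤ B s i j) →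
    ∀ v : ℝ → Fin N → ℝ,
      (∀ i : Fin N, ∀ s ∈ Set.Icc (0 : ℝ) σ,
        HasDerivAt (fun u => v u i)
          (-∑ j ∈ Finset.univ.erase i, B s i j * (v s i - v s j)) s) →
      (∑ j, v 0 j) = 0 →
      ∀ s ∈ Set.Icc (0 : ℝ) σ, ∀ i : Fin N,
        |v s i| * (s * b) ^ 3 ≤ C * ((1 / N) * ∑ j, |v 0 j|) := by
  refine ⟨80 ^ 4, by norm_num, ?_⟩
  intro N b σ hb _ γ hγ B _ hsymm hB v hv hsum s hs i
  have h : IsParabolicSolution B σ v := ⟨hsymm, fun s hs i j hij => (hB s hs i j hij).1, hv⟩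
  have hB' := fun s hs i j hij => (hB s hs i j hij).2
  have hup := h.mul_cube_le hb hγ hB' hsum hs i
  have hlow := h.neg.mul_cube_le hb hγ hB' (by simpa using hsum) hs i
  simp only [abs_neg] at hlow
  rcases abs_cases (v s i) with ⟨h', -⟩ | ⟨h', -⟩
  · rwa [h']
  · rwa [h']
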